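/- arXiv:1504.02279 — 2 statements merged into one kernel-verified Lean document; each statement's English description precedes it below -/
import Mathlib

section
/- Let R = ℤ[a,b,c,d,d⁻¹] and let H₄ be the quotient of the group algebra R[B₃] of the braid group on three strands by the relations sᵢ⁴ = a·sᵢ³ + b·sᵢ² + c·sᵢ + d for i = 1,2. Then H₄ is generated as an R-module by 96 elements. In particular H₄ is a finitely generated R-module. -/
/-- The braid relation of `B₃` inside the free group on two generators. -/
def braidRels : Set (FreeGroup (Fin 2)) :=
  {FreeGroup.of 0 * FreeGroup.of 1 * FreeGroup.of 0 *
    (FreeGroup.of 1 * FreeGroup.of 0 * FreeGroup.of 1)⁻¹}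

/-- The braid group on three strands `B₃ = ⟨s₁, s₂ | s₁s₂s₁ = s₂s₁s₂⟩`. -/
def B3 : Type := PresentedGroup braidRels

noncomputable instance : Group B3 := by unfold B3; infer_instance

/-- The generators `s₁, s₂` of `B₃`. -/
noncomputable def σ (i : Fin 2) : B3 := PresentedGroup.of i

/-- The ring `R₄ = ℤ[a,b,c,d,d⁻¹]`, realized as the localization of the polynomial
ring `ℤ[a,b,c,d]` away from `d`. -/
abbrev R4 : Type := Localization.Away (MvPolynomial.X 3 : MvPolynomial (Fin 4) ℤ)

/-- The coefficients `a, b, c, d` as elements of `R₄` (indices `0,1,2,3`). -/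
noncomputable def cf4 (i : Fin 4) : R4 :=
  algebraMap (MvPolynomial (Fin 4) ℤ) R4 (MvPolynomial.X i)

/-- The quartic relations `sᵢ⁴ = a sᵢ³ + b sᵢ² + c sᵢ + d` in the group algebra `R₄[B₃]`. -/
inductive quarticRel : MonoidAlgebra R4 B3 → MonoidAlgebra R4 B3 → Prop
  | rel (i : Fin 2) : quarticRel ((MonoidAlgebra.of R4 B3 (σ i)) ^ 4)
      (cf4 0 • (MonoidAlgebra.of R4 B3 (σ i)) ^ 3 +
       cf4 1 • (MonoidAlgebra.of R4 B3 (σ i)) ^ 2 +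
       cf4 2 • (MonoidAlgebra.of R4 B3 (σ i)) + cf4 3 • (1 : MonoidAlgebra R4 B3))

/-- The quartic Hecke algebra `H₄ = R₄[B₃] / (sᵢ⁴ - a sᵢ³ - b sᵢ² - c sᵢ - d)`. -/
abbrev H4 : Type := RingQuot quarticRel

namespace H4Proof

section GroupLemmas

variable {G : Type*} [Group G] {s t : G}

/-- The central element `z = (s t s)²`. -/
def zz (s t : G) : G := (s * t * s) * (s * t * s)

theorem conj1 (h : s * t * s = t * s * t) : t⁻¹ * s * t = s * t * s⁻¹ := by
  have : s * t = t * (s * t * s⁻¹) := by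
    have e : t * (s * t * s⁻¹) = (t * s * t) * s⁻¹ := by simp only [mul_assoc]
    rw [e, ← h, mul_inv_cancel_right]
  rw [mul_assoc, inv_mul_eq_iff_eq_mul]; exact this

theorem conj1z (h : s * t * s = t * s * t) (k : ℤ) : t⁻¹ * s ^ k * t = s * t ^ k * s⁻¹ := by
  have h1 : (t⁻¹ * s * t⁻¹⁻¹) ^ k = (s * t * s⁻¹) ^ k := by rw [inv_inv, conj1 h]
  rw [conj_zpow, conj_zpow, inv_inv] at h1
  exact h1

theorem conj2z (h : s * t * s = t * s * t) (k : ℤ) : t * s ^ k * t⁻¹ = s⁻¹ * t ^ k * s := by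
  rw [← conj1z h.symm k]

theorem zz_comm_s (h : s * t * s = t * s * t) : Commute (zz s t) s := by
  have h1 : s * t * s * s = t * (s * t * s) := by
    nth_rewrite 1 [h]; group
  have h2 : s * t * s * t = s * (s * t * s) := by
    nth_rewrite 2 [h]; group
  show zz s t * s = s * zz s t
  unfold zz
  rw [mul_assoc, h1, ← mul_assoc, h2, mul_assoc]

theorem zz_comm_t (h : s * t * s = t * s * t) : Commute (zz s t) t := by
  have : zz s t = zz t s := by unfold zz; rw [h]
  rw [this]; exact zz_comm_s h.symm

/-- `z t⁻¹ = s² t s²`. -/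
theorem tinv_eq (h : s * t * s = t * s * t) :
    zz s t * t⁻¹ = s ^ (2:ℤ) * t * s ^ (2:ℤ) := by
  rw [mul_inv_eq_iff_eq_mul]
  have e : s ^ (2:ℤ) * t * s ^ (2:ℤ) * t = s * (s * t * s) * (s * t) := by
    simp only [zpow_ofNat, pow_two, mul_assoc]
  rw [e, h]
  have e2 : s * (t * s * t) * (s * t) = s * t * s * (t * s * t) := by
    simp only [mul_assoc]
  rw [e2, ← h]; rfl

/-- `t sᵏ t = z s⁻¹ tᵏ⁻² s⁻¹`. -/
theorem tst (h : s * t * s = t * s * t) (k : ℤ) :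
    t * s ^ k * t = zz s t * (s⁻¹ * t ^ (k - 2) * s⁻¹) := by
  have e : s⁻¹ * t ^ (k - 2) * s⁻¹ = t * s ^ (k - 2) * t⁻¹ * s ^ (-2:ℤ) := by
    rw [conj2z h]; group
  have c : Commute (zz s t) (t * s ^ (k - 2)) :=
    (zz_comm_t h).mul_right ((zz_comm_s h).zpow_right _)
  calc t * s ^ k * t = t * s ^ (k - 2) * (s ^ (2:ℤ) * t * s ^ (2:ℤ)) * s ^ (-2:ℤ) := by group
    _ = t * s ^ (k - 2) * (zz s t * t⁻¹) * s ^ (-2:ℤ) := by rw [tinv_eq h]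
    _ = (t * s ^ (k - 2) * zz s t) * t⁻¹ * s ^ (-2:ℤ) := by simp only [mul_assoc]
    _ = zz s t * (s⁻¹ * t ^ (k - 2) * s⁻¹) := by rw [← c.eq, e]; simp only [mul_assoc]

end GroupLemmas

section Algebra

variable {R A : Type*} [CommRing R] [Ring A] [Algebra R A]

/-- The quartic relation for a unit. -/
def Quartic (a b c : R) (d : Rˣ) (u : Aˣ) : Prop :=
  (u : A) ^ 4 = a • (u : A) ^ 3 + b • (u : A) ^ 2 + c • (u : A) + (d : R) • (1 : A)

variable {a b c : R} {d : Rˣ} {u : Aˣ}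

theorem Quartic.expand (hq : Quartic a b c d u) (g h : Aˣ) (n : ℤ) :
    ((g * u ^ (n + 4) * h : Aˣ) : A) = a • ((g * u ^ (n + 3) * h : Aˣ) : A)
      + b • ((g * u ^ (n + 2) * h : Aˣ) : A) + c • ((g * u ^ (n + 1) * h : Aˣ) : A)
      + (d : R) • ((g * u ^ n * h : Aˣ) : A) := by
  have e4 : (u ^ (n + 4) : Aˣ) = u ^ n * u ^ 4 := by rw [zpow_add]; rfl
  have e3 : (u ^ (n + 3) : Aˣ) = u ^ n * u ^ 3 := by rw [zpow_add]; rfl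
  have e2 : (u ^ (n + 2) : Aˣ) = u ^ n * u ^ 2 := by rw [zpow_add]; rfl
  have e1 : (u ^ (n + 1) : Aˣ) = u ^ n * u := by rw [zpow_add, zpow_one]
  rw [e4, e3, e2, e1]
  unfold Quartic at hq
  simp only [Units.val_mul, Units.val_pow_eq_pow_val, hq]
  simp only [mul_add, add_mul, mul_smul_comm, smul_mul_assoc, mul_one]

/-- Four consecutive powers of `u` in a submodule force all integer powers. -/
theorem Quartic.zpow_mem (hq : Quartic a b c d u) (W : Submodule R A) (g h : Aˣ) (m : ℤ)
    (h0 : ((g * u ^ m * h : Aˣ) : A) ∈ W) (h1 : ((g * u ^ (m + 1) * h : Aˣ) : A) ∈ W)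
    (h2 : ((g * u ^ (m + 2) * h : Aˣ) : A) ∈ W) (h3 : ((g * u ^ (m + 3) * h : Aˣ) : A) ∈ W)
    (n : ℤ) : ((g * u ^ n * h : Aˣ) : A) ∈ W := by
  let P : ℤ → Prop := fun k => ((g * u ^ k * h : Aˣ) : A) ∈ W
  have up : ∀ k, P k → P (k + 1) → P (k + 2) → P (k + 3) → P (k + 4) := by
    intro k p0 p1 p2 p3
    show _ ∈ W
    rw [hq.expand]
    exact W.add_mem (W.add_mem (W.add_mem (W.smul_mem _ p3) (W.smul_mem _ p2))
      (W.smul_mem _ p1)) (W.smul_mem _ p0)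
  have down : ∀ k, P (k + 1) → P (k + 2) → P (k + 3) → P (k + 4) → P k := by
    intro k p1 p2 p3 p4
    have e := hq.expand g h k
    have : (d : R) • ((g * u ^ k * h : Aˣ) : A) ∈ W := by
      rw [← sub_eq_iff_eq_add'] at e
      rw [← e]
      exact W.sub_mem p4 (W.add_mem (W.add_mem (W.smul_mem _ p3) (W.smul_mem _ p2))
        (W.smul_mem _ p1))
    have h' := W.smul_mem ((d⁻¹ : Rˣ) : R) this
    rwa [smul_smul, Units.inv_mul, one_smul] at h'
  have key : ∀ k : ℤ, P k ∧ P (k + 1) ∧ P (k + 2) ∧ P (k + 3) := by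
    intro k
    induction k using Int.inductionOn' (b := m) with
    | zero => exact ⟨h0, h1, h2, h3⟩
    | succ k _ ih =>
      obtain ⟨p0, p1, p2, p3⟩ := ih
      have p4 := up k p0 p1 p2 p3
      refine ⟨p1, ?_, ?_, ?_⟩
      · rw [show k + 1 + 1 = k + 2 by ring]; exact p2
      · rw [show k + 1 + 2 = k + 3 by ring]; exact p3
      · rw [show k + 1 + 3 = k + 4 by ring]; exact p4
    | pred k _ ih =>
      obtain ⟨p0, p1, p2, p3⟩ := ih
      have q0 : P (k - 1 + 1) := by rw [show k - 1 + 1 = k by ring]; exact p0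
      have q1 : P (k - 1 + 2) := by rw [show k - 1 + 2 = k + 1 by ring]; exact p1
      have q2 : P (k - 1 + 3) := by rw [show k - 1 + 3 = k + 2 by ring]; exact p2
      have q3 : P (k - 1 + 4) := by rw [show k - 1 + 4 = k + 3 by ring]; exact p3
      exact ⟨down _ q0 q1 q2 q3, q0, q1, q2⟩
  exact (key n).1

/-- Index type of the 96 generators. -/
abbrev Idx : Type := (Fin 4 × Fin 4) ⊕ (Fin 4 × Fin 4 × Fin 4) ⊕ (Fin 4 × Fin 4)

/-- The 96 generators: `zᵏ sⁱ` and `zᵏ sⁱ t sʲ` for `-2 ≤ k ≤ 1`, `0 ≤ i, j ≤ 3`, and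
`sⁱ t² sʲ` for `0 ≤ i, j ≤ 3`. -/
def gen (s t : Aˣ) : Idx → Aˣ
  | .inl (k, i) => zz s t ^ ((k : ℤ) - 2) * s ^ (i : ℤ)
  | .inr (.inl (k, i, j)) => zz s t ^ ((k : ℤ) - 2) * (s ^ (i : ℤ) * t * s ^ (j : ℤ))
  | .inr (.inr (i, j)) => s ^ (i : ℤ) * t ^ (2 : ℤ) * s ^ (j : ℤ)

/-- The submodule spanned by the generators. -/
def W (R : Type*) {A : Type*} [CommRing R] [Ring A] [Algebra R A] (s t : Aˣ) : Submodule R A :=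
  Submodule.span R (Set.range fun x => ((gen s t x : Aˣ) : A))

variable {s t : Aˣ}

theorem fin4_extend (hq : Quartic a b c d u) (V : Submodule R A) (g h : Aˣ)
    (H : ∀ i : Fin 4, ((g * u ^ (i : ℤ) * h : Aˣ) : A) ∈ V) (n : ℤ) :
    ((g * u ^ n * h : Aˣ) : A) ∈ V :=
  hq.zpow_mem V g h 0 (H 0) (H 1) (H 2) (H 3) n

theorem mem_gen (x : Idx) : ((gen s t x : Aˣ) : A) ∈ W R s t :=
  Submodule.subset_span ⟨x, rfl⟩

theorem memU (hs : Quartic a b c d s) (k : Fin 4) (n : ℤ) :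
    ((zz s t ^ ((k : ℤ) - 2) * s ^ n : Aˣ) : A) ∈ W R s t := by
  have := fin4_extend hs (W R s t) (zz s t ^ ((k : ℤ) - 2)) 1
    (fun i => by rw [mul_one]; exact mem_gen (.inl (k, i))) n
  rwa [mul_one] at this

theorem memT (hs : Quartic a b c d s) (k : Fin 4) (m n : ℤ) :
    ((zz s t ^ ((k : ℤ) - 2) * (s ^ m * t * s ^ n) : Aˣ) : A) ∈ W R s t := by
  have h1 : ∀ i : Fin 4, ∀ n : ℤ,
      ((zz s t ^ ((k : ℤ) - 2) * (s ^ (i : ℤ) * t * s ^ n) : Aˣ) : A) ∈ W R s t := by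
    intro i n
    have := fin4_extend hs (W R s t) (zz s t ^ ((k : ℤ) - 2) * (s ^ (i : ℤ) * t)) 1
      (fun j => by
        have := mem_gen (R := R) (s := s) (t := t) (.inr (.inl (k, i, j)))
        simpa only [gen, mul_one, mul_assoc] using this) n
    simpa only [mul_one, mul_assoc] using this
  have := fin4_extend hs (W R s t) (zz s t ^ ((k : ℤ) - 2)) (t * s ^ n)
    (fun i => by have := h1 i n; simpa only [mul_assoc] using this) m
  simpa only [mul_assoc] using this

theorem memTT (hs : Quartic a b c d s) (m n : ℤ) :
    ((s ^ m * t ^ (2 : ℤ) * s ^ n : Aˣ) : A) ∈ W R s t := by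
  have h1 : ∀ i : Fin 4, ∀ n : ℤ,
      ((s ^ (i : ℤ) * t ^ (2 : ℤ) * s ^ n : Aˣ) : A) ∈ W R s t := by
    intro i n
    have := fin4_extend hs (W R s t) (s ^ (i : ℤ) * t ^ (2 : ℤ)) 1
      (fun j => by
        have := mem_gen (R := R) (s := s) (t := t) (.inr (.inr (i, j)))
        simpa only [gen, mul_one, mul_assoc] using this) n
    simpa only [mul_one, mul_assoc] using this
  have := fin4_extend hs (W R s t) 1 (t ^ (2 : ℤ) * s ^ n)
    (fun i => by have := h1 i n; simpa only [mul_assoc, one_mul] using this) m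
  simpa only [mul_assoc, one_mul] using this

/-- To check stability of `W` under right multiplication it is enough to look at generators. -/
theorem right_stable (g : Aˣ) (H : ∀ x, ((gen s t x * g : Aˣ) : A) ∈ W R s t) (y : A)
    (hy : y ∈ W R s t) : y * g ∈ W R s t := by
  unfold W at hy
  induction hy using Submodule.span_induction with
  | mem x hx =>
    obtain ⟨i, rfl⟩ := hx
    have := H i
    rwa [Units.val_mul] at this
  | zero => rw [zero_mul]; exact (W R s t).zero_mem
  | add x y _ _ hx hy => rw [add_mul]; exact (W R s t).add_mem hx hy
  | smul r x _ hx => rw [smul_mul_assoc]; exact (W R s t).smul_mem r hx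

theorem left_stable (g : Aˣ) (H : ∀ x, ((g * gen s t x : Aˣ) : A) ∈ W R s t) (y : A)
    (hy : y ∈ W R s t) : g * y ∈ W R s t := by
  unfold W at hy
  induction hy using Submodule.span_induction with
  | mem x hx =>
    obtain ⟨i, rfl⟩ := hx
    have := H i
    rwa [Units.val_mul] at this
  | zero => rw [mul_zero]; exact (W R s t).zero_mem
  | add x y _ _ hx hy => rw [mul_add]; exact (W R s t).add_mem hx hy
  | smul r x _ hx => rw [mul_smul_comm]; exact (W R s t).smul_mem r hx

theorem right_s (hs : Quartic a b c d s) (n : ℤ) (y : A) (hy : y ∈ W R s t) :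
    y * ((s ^ n : Aˣ) : A) ∈ W R s t := by
  refine right_stable _ ?_ y hy
  rintro (⟨k, i⟩ | ⟨k, i, j⟩ | ⟨i, j⟩)
  · have := memU (t := t) hs k (i + n)
    simpa only [gen, zpow_add, mul_assoc] using this
  · have := memT (t := t) hs k i (j + n)
    simpa only [gen, zpow_add, mul_assoc] using this
  · have := memTT (t := t) hs i (j + n)
    simpa only [gen, zpow_add, mul_assoc] using this

theorem left_s (h : s * t * s = t * s * t) (hs : Quartic a b c d s) (n : ℤ) (y : A)
    (hy : y ∈ W R s t) : ((s ^ n : Aˣ) : A) * y ∈ W R s t := by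
  have cz : ∀ k : ℤ, Commute (zz s t ^ k) (s ^ n) := fun k =>
    ((zz_comm_s h).zpow_right n).zpow_left k
  refine left_stable _ ?_ y hy
  rintro (⟨k, i⟩ | ⟨k, i, j⟩ | ⟨i, j⟩)
  · have := memU (t := t) hs k (n + i)
    rw [zpow_add, ← mul_assoc, (cz _).eq] at this
    simpa only [gen, mul_assoc] using this
  · have := memT (t := t) hs k (n + i) j
    rw [zpow_add, mul_assoc (s ^ n), mul_assoc (s ^ n), ← mul_assoc, (cz _).eq] at this
    simpa only [gen, mul_assoc] using this
  · have := memTT (t := t) hs (n + i) j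
    simpa only [gen, zpow_add, mul_assoc] using this

theorem bim (h : s * t * s = t * s * t) (hs : Quartic a b c d s) {k m n : ℤ} {g : Aˣ}
    (hg : ((zz s t ^ k * g : Aˣ) : A) ∈ W R s t) :
    ((zz s t ^ k * (s ^ m * g * s ^ n) : Aˣ) : A) ∈ W R s t := by
  have h1 := right_s hs n _ (left_s h hs m _ hg)
  rw [← Units.val_mul, ← Units.val_mul] at h1
  have cz : Commute (zz s t ^ k) (s ^ m) := ((zz_comm_s h).zpow_right m).zpow_left k
  rw [← mul_assoc (s ^ m), ← cz.eq] at h1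
  simpa only [mul_assoc] using h1

/-- Passing between `zᵏ⁺¹ t^{l-2}` and `zᵏ t s^l t`. -/
theorem tst_mem (h : s * t * s = t * s * t) (hs : Quartic a b c d s) {k l : ℤ}
    (hg : ((zz s t ^ (k + 1) * t ^ (l - 2) : Aˣ) : A) ∈ W R s t) :
    ((zz s t ^ k * (t * s ^ l * t) : Aˣ) : A) ∈ W R s t := by
  have := bim (m := -1) (n := -1) h hs hg
  rw [tst h l, ← mul_assoc, ← zpow_add_one]
  simpa only [zpow_neg, zpow_one] using this

theorem shift_neg (h : s * t * s = t * s * t) (hs : Quartic a b c d s) {k : ℤ}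
    (hg : ((zz s t ^ k * t ^ (1:ℤ) : Aˣ) : A) ∈ W R s t) :
    ((zz s t ^ (k + 1) * t ^ (-1:ℤ) : Aˣ) : A) ∈ W R s t := by
  rw [zpow_add_one, zpow_neg_one, mul_assoc, tinv_eq h]
  rw [zpow_one] at hg
  exact bim h hs hg

/-- `z t⁻² = s t² s`. -/
theorem sq_eq (h : s * t * s = t * s * t) :
    zz s t * t ^ (-2:ℤ) = s ^ (1:ℤ) * t ^ (2:ℤ) * s ^ (1:ℤ) := by
  have e := tst h 0
  rw [zpow_zero, mul_one] at e
  have e2 : t ^ (2:ℤ) = t * t := by rw [zpow_ofNat, pow_two]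
  have c : Commute (zz s t) s := zz_comm_s h
  rw [e2, e, zpow_one, ← mul_assoc s, ← c.eq]
  simp only [mul_assoc, mul_inv_cancel_left, inv_mul_cancel, mul_one]
  norm_num

theorem sq_up (h : s * t * s = t * s * t) (hs : Quartic a b c d s) {k : ℤ}
    (hg : ((zz s t ^ k * t ^ (2:ℤ) : Aˣ) : A) ∈ W R s t) :
    ((zz s t ^ (k + 1) * t ^ (-2:ℤ) : Aˣ) : A) ∈ W R s t := by
  rw [zpow_add_one, mul_assoc, sq_eq h]
  exact bim h hs hg

theorem sq_down (h : s * t * s = t * s * t) (hs : Quartic a b c d s) {k : ℤ}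
    (hg : ((zz s t ^ (k + 1) * t ^ (-2:ℤ) : Aˣ) : A) ∈ W R s t) :
    ((zz s t ^ k * t ^ (2:ℤ) : Aˣ) : A) ∈ W R s t := by
  rw [zpow_add_one, mul_assoc, sq_eq h] at hg
  have := bim (m := -1) (n := -1) h hs hg
  have e : s ^ (-1:ℤ) * (s ^ (1:ℤ) * t ^ (2:ℤ) * s ^ (1:ℤ)) * s ^ (-1:ℤ) = t ^ (2:ℤ) := by group
  rwa [e] at this

theorem tsinv (h : s * t * s = t * s * t) :
    t⁻¹ * s * t⁻¹ = (zz s t)⁻¹ * (s * t ^ (3:ℤ) * s) := by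
  have e := congrArg (fun x => x⁻¹) (tst h (-1))
  have c : Commute (zz s t) (s * t ^ (3:ℤ) * s) :=
    ((zz_comm_s h).mul_right ((zz_comm_t h).zpow_right _)).mul_right (zz_comm_s h)
  have e1 : (t * s ^ (-1:ℤ) * t)⁻¹ = t⁻¹ * s * t⁻¹ := by group
  have e2 : (zz s t * (s⁻¹ * t ^ ((-1:ℤ) - 2) * s⁻¹))⁻¹ =
      (s * t ^ (3:ℤ) * s) * (zz s t)⁻¹ := by
    simp only [mul_inv_rev, inv_inv, mul_assoc, ← zpow_neg]
    norm_num
  simp only [e1, e2] at e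
  rw [e, c.inv_left.eq]

section E

theorem E_neg_two (h : s * t * s = t * s * t) (hs : Quartic a b c d s)
    {k : ℤ} (hg : ((zz s t ^ (k - 1) * t ^ (3:ℤ) : Aˣ) : A) ∈ W R s t) :
    ((zz s t ^ k * (t * s ^ (-1:ℤ)) * t ^ (-2:ℤ) : Aˣ) : A) ∈ W R s t := by
  have e : t * s ^ (-1:ℤ) * t ^ (-2:ℤ) = (zz s t)⁻¹ * (t ^ (3:ℤ) * s) := by
    have e1 : t * s ^ (-1:ℤ) * t ^ (-2:ℤ) = (t * s ^ (-1:ℤ) * t⁻¹) * t⁻¹ := by group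
    have e2 : s⁻¹ * t ^ (-1:ℤ) * s * t⁻¹ = s⁻¹ * (t⁻¹ * s * t⁻¹) := by group
    rw [e1, conj2z h, e2, tsinv h, ← mul_assoc, ← (zz_comm_s h).inv_inv.eq]
    group
  rw [mul_assoc, e, ← mul_assoc, ← zpow_sub_one]
  simpa only [zpow_zero, one_mul, zpow_one] using bim (m := 0) (n := 1) h hs hg

theorem E_neg_one (h : s * t * s = t * s * t) (hs : Quartic a b c d s)
    {k : ℤ} (hg : ((zz s t ^ k * t ^ (-1:ℤ) : Aˣ) : A) ∈ W R s t) :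
    ((zz s t ^ k * (t * s ^ (-1:ℤ)) * t ^ (-1:ℤ) : Aˣ) : A) ∈ W R s t := by
  rw [mul_assoc, zpow_neg_one t, conj2z h]
  simpa only [zpow_neg_one, zpow_one] using bim (m := -1) (n := 1) h hs hg

theorem E_zero (h : s * t * s = t * s * t) (hs : Quartic a b c d s)
    {k : ℤ} (hg : ((zz s t ^ k * t ^ (1:ℤ) : Aˣ) : A) ∈ W R s t) :
    ((zz s t ^ k * (t * s ^ (-1:ℤ)) * t ^ (0:ℤ) : Aˣ) : A) ∈ W R s t := by
  simpa only [zpow_zero, one_mul, mul_one, zpow_one] using bim (m := 0) (n := -1) h hs hg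

theorem E_one (h : s * t * s = t * s * t) (hs : Quartic a b c d s)
    {k : ℤ} (hg : ((zz s t ^ (k + 1) * t ^ (-3:ℤ) : Aˣ) : A) ∈ W R s t) :
    ((zz s t ^ k * (t * s ^ (-1:ℤ)) * t ^ (1:ℤ) : Aˣ) : A) ∈ W R s t := by
  rw [mul_assoc, zpow_one t]
  exact tst_mem h hs hg

end E

section Levels

/-- Four consecutive powers of `t` at level `k` give all powers of `t` at level `k`. -/
theorem level (ht : Quartic a b c d t)
    {k : ℤ} (m : ℤ)
    (h0 : ((zz s t ^ k * t ^ m : Aˣ) : A) ∈ W R s t)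
    (h1 : ((zz s t ^ k * t ^ (m + 1) : Aˣ) : A) ∈ W R s t)
    (h2 : ((zz s t ^ k * t ^ (m + 2) : Aˣ) : A) ∈ W R s t)
    (h3 : ((zz s t ^ k * t ^ (m + 3) : Aˣ) : A) ∈ W R s t) (n : ℤ) :
    ((zz s t ^ k * t ^ n : Aˣ) : A) ∈ W R s t := by
  have := ht.zpow_mem (W R s t) (zz s t ^ k) 1 m (by rwa [mul_one]) (by rwa [mul_one])
    (by rwa [mul_one]) (by rwa [mul_one]) n
  rwa [mul_one] at this

theorem base0 (hs : Quartic a b c d s)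
    (k : Fin 4) : ((zz s t ^ ((k : ℤ) - 2) * t ^ (0:ℤ) : Aˣ) : A) ∈ W R s t := by
  simpa only [zpow_zero] using memU (t := t) hs k 0

theorem base1 (hs : Quartic a b c d s)
    (k : Fin 4) : ((zz s t ^ ((k : ℤ) - 2) * t ^ (1:ℤ) : Aˣ) : A) ∈ W R s t := by
  simpa only [zpow_zero, one_mul, mul_one, zpow_one] using memT (t := t) hs k 0 0

theorem level_zero (h : s * t * s = t * s * t) (hs : Quartic a b c d s) (ht : Quartic a b c d t)
    (n : ℤ) : ((zz s t ^ (0:ℤ) * t ^ n : Aˣ) : A) ∈ W R s t := by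
  refine level ht (-1) (shift_neg h hs (base1 hs 1)) (base0 hs 2) (base1 hs 2) ?_ n
  have := memTT (t := t) hs 0 0
  rw [zpow_zero, one_mul, mul_one] at this
  change ((zz s t ^ (0:ℤ) * t ^ (2:ℤ) : Aˣ) : A) ∈ W R s t
  rwa [zpow_zero, one_mul]

theorem level_one (h : s * t * s = t * s * t) (hs : Quartic a b c d s) (ht : Quartic a b c d t)
    (n : ℤ) : ((zz s t ^ (1:ℤ) * t ^ n : Aˣ) : A) ∈ W R s t :=
  level ht (-2) (sq_up h hs (level_zero h hs ht 2)) (shift_neg h hs (base1 hs 2))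
    (base0 hs 3) (base1 hs 3) n

theorem level_neg_one (h : s * t * s = t * s * t) (hs : Quartic a b c d s) (ht : Quartic a b c d t)
    (n : ℤ) : ((zz s t ^ (-1:ℤ) * t ^ n : Aˣ) : A) ∈ W R s t :=
  level ht (-1) (shift_neg h hs (base1 hs 0)) (base0 hs 1) (base1 hs 1)
    (sq_down h hs (level_zero h hs ht (-2))) n

/-- `z⁻¹ t s⁻¹ t²` lies in `W`. -/
theorem key_mem (h : s * t * s = t * s * t) (hs : Quartic a b c d s) (ht : Quartic a b c d t)
    : ((zz s t ^ (-1:ℤ) * (t * s ^ (-1:ℤ)) * t ^ (2:ℤ) : Aˣ) : A) ∈ W R s t := by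
  have e : zz s t ^ (-1:ℤ) * (t * s ^ (-1:ℤ)) * t ^ (2:ℤ)
      = s⁻¹ * t ^ (-3:ℤ) * (s⁻¹ * t) := by
    have e1 : zz s t ^ (-1:ℤ) * (t * s ^ (-1:ℤ)) * t ^ (2:ℤ)
      = zz s t ^ (-1:ℤ) * (t * s ^ (-1:ℤ) * t) * t := by
      have : t ^ (2:ℤ) = t * t := by rw [zpow_ofNat, pow_two]
      simp only [this, mul_assoc]
    rw [e1, tst h]
    group
  rw [e]
  refine ht.zpow_mem (W R s t) s⁻¹ (s⁻¹ * t) (-2) ?_ ?_ ?_ ?_ (-3)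
  · have e2 : s⁻¹ * t ^ (-2:ℤ) * (s⁻¹ * t) = s⁻¹ * t⁻¹ * (t⁻¹ * s ^ (-1:ℤ) * t) := by group
    have e3 : s⁻¹ * t⁻¹ * (s * t ^ (-1:ℤ) * s⁻¹) = s⁻¹ * (t⁻¹ * s * t⁻¹) * s⁻¹ := by group
    rw [e2, conj1z h, e3, tsinv h, ← mul_assoc, ← (zz_comm_s h).inv_inv.eq]
    have := bim (m := 0) (n := 0) h hs (level_neg_one h hs ht 3)
    have e4 : (zz s t)⁻¹ * s⁻¹ * (s * t ^ (3:ℤ) * s) * s⁻¹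
      = zz s t ^ (-1:ℤ) * (s ^ (0:ℤ) * t ^ (3:ℤ) * s ^ (0:ℤ)) := by group
    rwa [e4]
  · have e2 : s⁻¹ * t ^ ((-2:ℤ) + 1) * (s⁻¹ * t) = s⁻¹ * (t⁻¹ * s ^ (-1:ℤ) * t) := by group
    have e3 : s⁻¹ * (s * t ^ (-1:ℤ) * s⁻¹)
      = zz s t ^ (0:ℤ) * (s ^ (0:ℤ) * t ^ (-1:ℤ) * s ^ (-1:ℤ)) := by group
    rw [e2, conj1z h, e3]
    exact bim h hs (level_zero h hs ht (-1))
  · have e2 : s⁻¹ * t ^ ((-2:ℤ) + 2) * (s⁻¹ * t)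
      = zz s t ^ (0:ℤ) * (s ^ (-2:ℤ) * t ^ (1:ℤ) * s ^ (0:ℤ)) := by group
    rw [e2]
    exact bim h hs (level_zero h hs ht 1)
  · have e2 : s⁻¹ * t ^ ((-2:ℤ) + 3) * (s⁻¹ * t)
      = s⁻¹ * (t * s ^ (-1:ℤ) * t) := by group
    have e3 : s⁻¹ * (zz s t * (s⁻¹ * t ^ ((-1:ℤ) - 2) * s⁻¹))
      = (s⁻¹ * zz s t) * (s⁻¹ * t ^ ((-1:ℤ) - 2) * s⁻¹) := by group
    have e4 : (zz s t * s⁻¹) * (s⁻¹ * t ^ ((-1:ℤ) - 2) * s⁻¹)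
      = zz s t ^ (1:ℤ) * (s ^ (-2:ℤ) * t ^ (-3:ℤ) * s ^ (-1:ℤ)) := by group
    rw [e2, tst h, e3, ← (zz_comm_s h).inv_right.eq, e4]
    exact bim h hs (level_one h hs ht (-3))

theorem level_neg_two (h : s * t * s = t * s * t) (hs : Quartic a b c d s) (ht : Quartic a b c d t)
    (n : ℤ) : ((zz s t ^ (-2:ℤ) * t ^ n : Aˣ) : A) ∈ W R s t := by
  refine level ht 0 (base0 hs 0) (base1 hs 0)
    (sq_down h hs (level_neg_one h hs ht (-2))) ?_ n
  have h1 := ht.zpow_mem (W R s t) (zz s t ^ (-1:ℤ) * (t * s ^ (-1:ℤ))) 1 (-1)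
    (by rw [mul_one]; exact E_neg_one h hs (level_neg_one h hs ht _))
    (by rw [mul_one]; exact E_zero h hs (level_neg_one h hs ht _))
    (by rw [mul_one]; exact E_one h hs (level_zero h hs ht _))
    (by rw [mul_one]; exact key_mem h hs ht) (-2)
  have e : zz s t ^ (-1:ℤ) * (t * s ^ (-1:ℤ)) * t ^ (-2:ℤ) * 1
      = zz s t ^ (-2:ℤ) * (t ^ (3:ℤ) * s) := by
    have e1 : zz s t ^ (-1:ℤ) * (t * s ^ (-1:ℤ)) * t ^ (-2:ℤ) * 1
      = zz s t ^ (-1:ℤ) * ((t * s ^ (-1:ℤ) * t⁻¹) * t⁻¹) := by group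
    have e2 : s⁻¹ * t ^ (-1:ℤ) * s * t⁻¹ = s⁻¹ * (t⁻¹ * s * t⁻¹) := by group
    rw [e1, conj2z h, e2, tsinv h, ← mul_assoc s⁻¹, ← (zz_comm_s h).inv_inv.eq]
    group
  rw [e] at h1
  have h2 := bim (m := 0) (n := -1) h hs h1
  have e5 : s ^ (0:ℤ) * (t ^ (3:ℤ) * s) * s ^ (-1:ℤ) = t ^ (3:ℤ) := by group
  rwa [e5] at h2

theorem level_all (h : s * t * s = t * s * t) (hs : Quartic a b c d s) (ht : Quartic a b c d t)
    (k : Fin 4) (n : ℤ) :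
    ((zz s t ^ ((k : ℤ) - 2) * t ^ n : Aˣ) : A) ∈ W R s t := by
  fin_cases k
  · exact level_neg_two h hs ht n
  · exact level_neg_one h hs ht n
  · exact level_zero h hs ht n
  · exact level_one h hs ht n

theorem right_tinv (h : s * t * s = t * s * t) (hs : Quartic a b c d s) (ht : Quartic a b c d t)
    (y : A) (hy : y ∈ W R s t) : y * ((t⁻¹ : Aˣ) : A) ∈ W R s t := by
  refine right_stable _ ?_ y hy
  rintro (⟨k, i⟩ | ⟨k, i, j⟩ | ⟨i, j⟩)
  · have := bim (m := i) (n := 0) h hs (level_all h hs ht k (-1))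
    simpa only [gen, zpow_zero, zpow_neg_one, mul_one, mul_assoc] using this
  · have := bim (m := i - 1) (n := 1) h hs (level_all h hs ht k j)
    have e : gen s t (.inr (.inl (k, i, j))) * t⁻¹
        = zz s t ^ ((k : ℤ) - 2) * (s ^ (i : ℤ) * (t * s ^ (j : ℤ) * t⁻¹)) := by
      simp only [gen, mul_assoc]
    rw [e, conj2z h]
    simpa only [zpow_sub_one, zpow_one, mul_assoc] using this
  · have h1 := ht.zpow_mem (W R s t) (zz s t ^ (0:ℤ) * (t * s ^ (-1:ℤ))) 1 (-2)
      (by rw [mul_one]; exact E_neg_two h hs (level_neg_one h hs ht _))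
      (by rw [mul_one]; exact E_neg_one h hs (level_zero h hs ht _))
      (by rw [mul_one]; exact E_zero h hs (level_zero h hs ht _))
      (by rw [mul_one]; exact E_one h hs (level_one h hs ht _)) j
    rw [mul_one, mul_assoc] at h1
    have h2 := bim (m := i) (n := 1) h hs h1
    have e : gen s t (.inr (.inr (i, j))) * t⁻¹
        = s ^ (i : ℤ) * t * (t * s ^ (j : ℤ) * t⁻¹) := by
      have : t ^ (2:ℤ) = t * t := by rw [zpow_ofNat, pow_two]
      simp only [gen, mul_assoc, this]
    rw [e, conj2z h]
    simpa only [zpow_zero, zpow_one, zpow_neg_one, one_mul, mul_assoc] using h2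

theorem right_t (h : s * t * s = t * s * t) (hs : Quartic a b c d s) (ht : Quartic a b c d t)
    (y : A) (hy : y ∈ W R s t) : y * ((t : Aˣ) : A) ∈ W R s t := by
  refine right_stable _ ?_ y hy
  intro x
  have m0 := mem_gen (R := R) (s := s) (t := t) x
  have m1 := right_tinv h hs ht _ m0
  have m2 := right_tinv h hs ht _ m1
  have m3 := right_tinv h hs ht _ m2
  simp only [← Units.val_mul] at m1 m2 m3
  have := ht.zpow_mem (W R s t) (gen s t x) 1 (-3)
    (by convert m3 using 2; group) (by convert m2 using 2; group)
    (by convert m1 using 2; group) (by convert m0 using 2; group) 1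
  simpa only [zpow_one, mul_one] using this

theorem one_mem (h : s * t * s = t * s * t) (hs : Quartic a b c d s) (ht : Quartic a b c d t)
    : (1 : A) ∈ W R s t := by
  simpa using level_zero h hs ht 0

/-- `W` is stable under right multiplication by the group generated by `s` and `t`. -/
theorem right_closure (h : s * t * s = t * s * t) (hs : Quartic a b c d s) (ht : Quartic a b c d t)
    (g : Aˣ) (hg : g ∈ Subgroup.closure ({s, t} : Set Aˣ)) :
    ∀ y ∈ W R s t, y * (g : A) ∈ W R s t := by
  induction hg using Subgroup.closure_induction'' with
  | mem x hx =>
    intro y hy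
    rcases hx with rfl | rfl
    · simpa using right_s hs 1 y hy
    · exact right_t h hs ht y hy
  | inv_mem x hx =>
    intro y hy
    rcases hx with rfl | rfl
    · simpa using right_s hs (-1) y hy
    · exact right_tinv h hs ht y hy
  | one => intro y hy; simpa using hy
  | mul x y _ _ hx hy =>
    intro w hw
    rw [Units.val_mul, ← mul_assoc]
    exact hy _ (hx _ hw)

theorem closure_mem (h : s * t * s = t * s * t) (hs : Quartic a b c d s) (ht : Quartic a b c d t)
    (g : Aˣ) (hg : g ∈ Subgroup.closure ({s, t} : Set Aˣ)) :
    (g : A) ∈ W R s t := by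
  simpa using right_closure h hs ht g hg 1 (one_mem h hs ht)

end Levels

end Algebra

end H4Proof

namespace H4Proof

/-- The coefficient `d` as a unit. -/
noncomputable def dU : R4ˣ :=
  (IsLocalization.Away.algebraMap_isUnit (S := R4)
    (MvPolynomial.X 3 : MvPolynomial (Fin 4) ℤ)).unit

theorem dU_val : (dU : R4) = cf4 3 := rfl

/-- The map from the braid group to the units of `H4`. -/
noncomputable def toH : B3 →* H4ˣ :=
  (Units.map ((RingQuot.mkAlgHom R4 quarticRel : MonoidAlgebra R4 B3 →ₐ[R4] H4) :
    MonoidAlgebra R4 B3 →* H4)).comp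
    ((Units.map (MonoidAlgebra.of R4 B3)).comp (toUnits (G := B3)).toMonoidHom)

theorem toH_val (g : B3) : ((toH g : H4ˣ) : H4) =
    RingQuot.mkAlgHom R4 quarticRel (MonoidAlgebra.of R4 B3 g) := rfl

theorem toH_quartic (i : Fin 2) : Quartic (A := H4) (cf4 0) (cf4 1) (cf4 2) dU (toH (σ i)) := by
  have := RingQuot.mkAlgHom_rel R4 (quarticRel.rel i)
  unfold Quartic
  rw [dU_val, toH_val]
  simpa only [map_pow, map_add, map_smul, map_one] using this

theorem braid : σ 0 * σ 1 * σ 0 = σ 1 * σ 0 * σ 1 := by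
  have h : (PresentedGroup.mk braidRels (FreeGroup.of 0 * FreeGroup.of 1 * FreeGroup.of 0 *
    (FreeGroup.of 1 * FreeGroup.of 0 * FreeGroup.of 1)⁻¹)) = 1 :=
    PresentedGroup.one_of_mem (rels := braidRels) rfl
  rw [map_mul, map_inv, mul_inv_eq_one] at h
  exact h

theorem toH_braid : toH (σ 0) * toH (σ 1) * toH (σ 0) = toH (σ 1) * toH (σ 0) * toH (σ 1) := by
  simp only [← map_mul, braid]

theorem closure_B3 (g : B3) : g ∈ Subgroup.closure ({σ 0, σ 1} : Set B3) := by
  have h : Subgroup.closure (Set.range (PresentedGroup.of (rels := braidRels))) = ⊤ :=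
    PresentedGroup.closure_range_of braidRels
  have h2 : (Set.range (PresentedGroup.of (rels := braidRels)) : Set (PresentedGroup braidRels))
      ⊆ ({σ 0, σ 1} : Set B3) := by
    rintro _ ⟨i, rfl⟩
    fin_cases i
    · exact Or.inl rfl
    · exact Or.inr rfl
  have h3 : (⊤ : Subgroup (PresentedGroup braidRels)) ≤
      Subgroup.closure ({σ 0, σ 1} : Set B3) := by
    rw [← h]; exact Subgroup.closure_mono h2
  exact h3 (Subgroup.mem_top g)

theorem toH_mem (g : B3) : ((toH g : H4ˣ) : H4) ∈ W R4 (A := H4) (toH (σ 0)) (toH (σ 1)) := by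
  refine closure_mem (A := H4) toH_braid (toH_quartic 0) (toH_quartic 1) _ ?_
  have h1 : toH g ∈ (Subgroup.closure ({σ 0, σ 1} : Set B3)).map toH := ⟨g, closure_B3 g, rfl⟩
  rw [MonoidHom.map_closure, Set.image_pair] at h1
  exact h1

theorem W_eq_top : W R4 (A := H4) (toH (σ 0)) (toH (σ 1)) = ⊤ := by
  rw [eq_top_iff]
  rintro x -
  obtain ⟨y, rfl⟩ := RingQuot.mkAlgHom_surjective R4 quarticRel x
  induction y using MonoidAlgebra.induction_on with
  | of g => exact toH_mem g
  | add p q hp hq => rw [map_add]; exact Submodule.add_mem _ hp hq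
  | smul r p hp => rw [map_smul]; exact Submodule.smul_mem _ r hp

/-- The specialization `a = b = c = 0`, `d = 1` of the coefficient ring. -/
noncomputable def spec : R4 →+* ℤ :=
  IsLocalization.Away.lift (S := R4) (MvPolynomial.X 3 : MvPolynomial (Fin 4) ℤ)
    (g := MvPolynomial.eval₂Hom (RingHom.id ℤ) ![0, 0, 0, 1]) (by simp)

theorem spec_cf (i : Fin 4) : spec (cf4 i) = (![0, 0, 0, 1] : Fin 4 → ℤ) i := by
  unfold spec cf4
  rw [IsLocalization.Away.lift_eq]
  simp

/-- `H4` is infinite: it maps to `ℤ` by the specialization above and `sᵢ ↦ 1`. -/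
theorem infinite_H4 : Infinite H4 := by
  let _ : Algebra R4 ℤ := spec.toAlgebra
  let f : MonoidAlgebra R4 B3 →ₐ[R4] ℤ := MonoidAlgebra.lift R4 ℤ B3 1
  have hf : ∀ g, f (MonoidAlgebra.of R4 B3 g) = 1 := fun g => by
    simp [f]
  have hsm : ∀ (r : R4) (x : ℤ), r • x = spec r * x := fun r x => rfl
  have hrel : ∀ ⦃x y : MonoidAlgebra R4 B3⦄, quarticRel x y → f x = f y := by
    rintro _ _ ⟨i⟩
    simp only [map_pow, map_add, map_smul, map_one, hf, hsm, spec_cf]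
    simp
  let F : H4 →ₐ[R4] ℤ := RingQuot.liftAlgHom R4 ⟨f, hrel⟩
  refine Infinite.of_injective (fun n : ℕ => (n : H4)) ?_
  intro m n hmn
  have := congrArg F hmn
  have hF : ∀ k : ℕ, F (k : H4) = (k : ℤ) := fun k => map_natCast F k
  simp only [hF] at this
  exact_mod_cast this

end H4Proof

theorem H4_generated_by_96_elements :
    (∃ S : Finset H4, S.card = 96 ∧ Submodule.span R4 (S : Set H4) = ⊤) ∧
    Module.Finite R4 H4 := by 
  classical
  have := H4Proof.infinite_H4
  let f : H4Proof.Idx → H4 := fun x =>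
    ((H4Proof.gen (A := H4) (H4Proof.toH (σ 0)) (H4Proof.toH (σ 1)) x : H4ˣ) : H4)
  have hcard : (Finset.univ.image f).card ≤ 96 := by
    refine Finset.card_image_le.trans ?_
    simp [H4Proof.Idx]
  obtain ⟨S, hS, hS96⟩ := Infinite.exists_superset_card_eq (Finset.univ.image f) 96 hcard
  have hspan : Submodule.span R4 (S : Set H4) = ⊤ := by
    rw [eq_top_iff, ← H4Proof.W_eq_top]
    refine Submodule.span_mono ?_
    rintro _ ⟨x, rfl⟩
    exact hS (Finset.mem_image_of_mem f (Finset.mem_univ x))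
  exact ⟨⟨S, hS96, hspan⟩, ⟨⟨S, hspan⟩⟩⟩
end

section
/- Let R = ℤ[a,b,c,d,e,e⁻¹] and let H₅ be the quotient of the group algebra R[B₃] by the relations sᵢ⁵ = a·sᵢ⁴ + b·sᵢ³ + c·sᵢ² + d·sᵢ + e for i = 1,2. Then H₅ is generated as an R-module by 600 elements. In particular H₅ is a finitely generated R-module. -/
/-- The ring `R₄ = ℤ[a,b,c,d,e,e⁻¹]`, realized as the localization of the polynomial
ring `ℤ[a,b,c,d,e]` away from `e`. -/
abbrev R5 : Type := Localization.Away (MvPolynomial.X 4 : MvPolynomial (Fin 5) ℤ)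

/-- The coefficients `a, b, c, d` as elements of `R₄` (indices `0,1,2,3`). -/
noncomputable def cf5 (i : Fin 5) : R5 :=
  algebraMap (MvPolynomial (Fin 5) ℤ) R5 (MvPolynomial.X i)

/-- The quintic relations `sᵢ⁵ = a sᵢ⁴ + b sᵢ³ + c sᵢ² + d sᵢ + e` in the group algebra `R₄[B₃]`. -/
inductive quinticRel : MonoidAlgebra R5 B3 → MonoidAlgebra R5 B3 → Prop
  | rel (i : Fin 2) : quinticRel ((MonoidAlgebra.of R5 B3 (σ i)) ^ 5)
      (cf5 0 • (MonoidAlgebra.of R5 B3 (σ i)) ^ 4 +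
       cf5 1 • (MonoidAlgebra.of R5 B3 (σ i)) ^ 3 +
       cf5 2 • (MonoidAlgebra.of R5 B3 (σ i)) ^ 2 +
       cf5 3 • (MonoidAlgebra.of R5 B3 (σ i)) + cf5 4 • (1 : MonoidAlgebra R5 B3))

/-- The quartic Hecke algebra `H₄ = R₄[B₃] / (sᵢ⁴ - a sᵢ³ - b sᵢ² - c sᵢ - d)`. -/
abbrev H5 : Type := RingQuot quinticRel

/-! ### Combinatorial part: normal forms for cosets of `⟨s₁⟩` in `B₃` -/

/-- Letters of the normal form: `U` stands for `s₁s₂s₁`, `Y` for `s₁s₂`, `W` for `(s₁s₂)²`. -/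
inductive Letter where
  | U
  | Y
  | W

/-- Code of a letter. -/
def Letter.code : Letter → ℕ
  | U => 1
  | Y => 2
  | W => 3

theorem Letter.code_inj (a b : Letter) : a.code = b.code ↔ a = b := by
  cases a <;> cases b <;> simp [Letter.code]

instance : DecidableEq Letter := fun a b => decidable_of_iff _ (Letter.code_inj a b)

/-- A normal form: the exponent of the central element and the word (last letter first). -/
abbrev St : Type := ℤ × List Letter

/-- Right multiplication by `s₁s₂s₁`, up to left multiplication by powers of `s₁`. -/
def mulU : St → St
  | (k, []) => (k, [Letter.W])
  | (k, [Letter.W]) => (k + 1, [])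
  | (k, Letter.U :: l) => (k + 1, l)
  | (k, l) => (k, Letter.U :: l)

/-- Right multiplication by `s₁s₂`. -/
def mulY : St → St
  | (k, Letter.Y :: l) => (k, Letter.W :: l)
  | (k, Letter.W :: l) => (k + 1, l)
  | (k, l) => (k, Letter.Y :: l)

/-- Right multiplication by the inverse of the central element `(s₁s₂)³`. -/
def dz (s : St) : St := (s.1 - 1, s.2)

/-- Right multiplication by a generator (`s₂` for `true`, `s₁` for `false`). -/
def gen : Bool → St → St
  | true, s => dz (mulY (mulY (mulU s)))
  | false, s => dz (mulU (mulY (mulY s)))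

/-- Right multiplication by an inverse generator. -/
def genInv : Bool → St → St
  | true, s => dz (mulU (mulY s))
  | false, s => dz (mulY (mulU s))

/-- Iterate a map. -/
def rep (f : St → St) : ℕ → St → St
  | 0, s => s
  | n + 1, s => rep f n (f s)

/-- Act by the power `d - 10` of a generator. -/
def pw (c : Bool) (d : ℕ) (s : St) : St :=
  match Nat.ble 10 d with
  | true => rep (gen c) (d - 10) s
  | false => rep (genInv c) (10 - d) s

/-- Act by the encoded word `m` (base `20` digits are exponents plus `10`). -/
def act : ℕ → Bool → ℕ → St → St
  | 0, _, _, s => s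
  | f + 1, c, m, s =>
    match Nat.beq m 0 with
    | true => s
    | false => act f (!c) (m / 20) (pw c (m % 20) s)

/-- The state of a basis datum. -/
def ofData (x : ℕ × ℕ) : St := act 12 true x.2 ((x.1 : ℤ) - 10, [])

/-- A search tree of states. -/
inductive STree where
  | leaf
  | node (l : STree) (k : ℕ) (s : St) (r : STree)

/-- Hash of a list of letters. -/
def lkey : List Letter → ℕ → ℕ
  | [], a => a
  | x :: l, a => lkey l (4 * a + x.code)

/-- Key of a state. -/
def key (s : St) : ℕ := lkey s.2 (s.1 + 100).toNat

/-- Insertion in a search tree. -/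
def STree.ins (k : ℕ) (s : St) : STree → STree
  | leaf => node leaf k s leaf
  | node l k' s' r =>
    match Nat.ble k k' with
    | true => node (l.ins k s) k' s' r
    | false => node l k' s' (r.ins k s)

/-- Search. -/
def STree.mem (k : ℕ) (s : St) : STree → Bool
  | leaf => false
  | node l k' s' r =>
    match Nat.beq k k' with
    | true => decide (s = s')
    | false =>
      match Nat.ble k k' with
      | true => l.mem k s
      | false => r.mem k s

/-- Membership of a state. -/
def STree.has (t : STree) (s : St) : Bool := t.mem (key s) s

/-- Move by `s₁` or its inverse. -/
def mv (dir : ℕ) (s : St) : St :=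
  match dir with
  | 0 => genInv false s
  | _ => gen false s

/-- Check one derivation step. -/
def stepOk (t : STree) (dir p : ℕ) (s : St) : ℕ → Bool
  | 0 => true
  | n + 1 =>
    match t.has (act 12 true p (mv dir s)) with
    | true => stepOk t dir p (mv dir s) n
    | false => false

/-- Run the derivation. -/
def run : List (ℕ × ℕ × ℕ) → STree → Option STree
  | [], t => some t
  | (n, q, p) :: ss, t =>
    match stepOk t (n % 2) p (act 12 true q (((n / 2 : ℕ) : ℤ) - 10, [])) 5 with
    | true =>
      run ss (t.ins (key (act 12 true p (act 12 true q (((n / 2 : ℕ) : ℤ) - 10, []))))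
        (act 12 true p (act 12 true q (((n / 2 : ℕ) : ℤ) - 10, []))))
    | false => none

/-- Insert the basis states. -/
def initTree : List (ℕ × ℕ) → STree
  | [] => STree.leaf
  | x :: l => (initTree l).ins (key (ofData x)) (ofData x)

/-- The full check of a certificate. -/
def finalOk (t : STree) : List (ℕ × ℕ) → Bool
  | [] => t.has (0, [])
  | x :: l =>
    match t.has (gen false (ofData x)), t.has (gen true (ofData x)) with
    | true, true => finalOk t l
    | _, _ => false

/-- The full check of a certificate. -/
def checkAll (b : List (ℕ × ℕ)) (ss : List (ℕ × ℕ × ℕ)) : Bool :=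
  match run ss (initTree b) with
  | some t => finalOk t b
  | none => false

/-- The 120 coset representatives: pairs (level plus 10, encoded word). -/
def basisData : List (ℕ × ℕ) := [
  (9, 0), (11, 0), (10, 0), (8, 0), (9, 189), (9, 169), (12, 189), (10, 189), (11, 189), (10, 169),
  (12, 169), (11, 169), (12, 0), (8, 189), (9, 9), (9, 149), (11, 9), (10, 9), (10, 149),
  (12, 149), (11, 149), (12, 9), (9, 4569), (8, 169), (13, 169), (10, 4569), (12, 4569),
  (11, 4569), (8, 9), (7, 0), (9, 229), (13, 189), (11, 229), (10, 229), (12, 129), (9, 8),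
  (9, 76569), (13, 149), (12, 8), (10, 8), (11, 8), (10, 76569), (12, 76569), (11, 76569), (13, 0),
  (8, 229), (9, 4969), (12, 4549), (8, 4569), (7, 189), (8, 149), (13, 129), (12, 7), (9, 228),
  (9, 68569), (11, 228), (10, 228), (9, 3829), (10, 68569), (7, 169), (12, 68569), (13, 9),
  (11, 68569), (7, 9), (6, 0), (12, 76549), (12, 228), (8, 4969), (14, 169), (9, 4949),
  (9, 1836569), (10, 4949), (12, 4949), (11, 4949), (8, 76569), (8, 3829), (13, 4549), (14, 189),
  (7, 229), (9, 76949), (12, 227), (9, 91829), (12, 3429), (14, 149), (7, 4569), (14, 0),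
  (12, 68549), (9, 30636569), (13, 76549), (12, 3828), (6, 189), (7, 149), (9, 1996569),
  (8, 91829), (12, 1836549), (13, 7), (14, 129), (6, 169), (6, 9), (9, 68949), (5, 0), (13, 68549),
  (7, 4969), (12, 3428), (14, 9), (8, 99829), (9, 1531829), (15, 169), (9, 1836949), (13, 60549),
  (6, 229), (15, 189), (6, 4569), (15, 149), (6, 149), (9, 30636949), (9, 36731829), (12, 91428),
  (12, 734628569), (5, 9)]

/-- Derivation steps, part 1. -/
def steps1 : List (ℕ × ℕ × ℕ) := [
  (19, 129, 0), (21, 129, 0), (23, 129, 0), (24, 229, 0), (21, 109, 169), (20, 229, 189),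
  (24, 229, 189), (23, 109, 169), (22, 229, 189), (25, 109, 169), (18, 249, 0), (22, 249, 0),
  (20, 249, 0), (25, 109, 0), (19, 129, 189), (21, 109, 189), (18, 229, 169), (23, 109, 189),
  (25, 109, 189), (16, 249, 0), (20, 229, 169), (24, 229, 169), (18, 249, 189), (22, 229, 169),
  (26, 9, 189), (27, 89, 169), (20, 229, 9), (22, 229, 9), (24, 229, 9), (26, 9, 169),
  (25, 109, 149), (27, 109, 0), (27, 89, 189), (19, 129, 9), (19, 109, 169), (17, 129, 0),
  (21, 109, 9), (18, 248, 0), (18, 249, 9), (19, 60569, 0), (25, 109, 9), (22, 248, 0),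
  (23, 109, 9), (21, 60569, 0), (20, 248, 0), (25, 60569, 0), (24, 229, 149), (23, 60569, 0),
  (16, 249, 189), (27, 89, 149), (24, 248, 0), (26, 229, 0), (16, 229, 169), (17, 129, 189),
  (14, 249, 0), (25, 60549, 0), (24, 247, 0), (17, 109, 169), (29, 109, 0), (14, 249, 189),
  (26, 227, 0), (15, 129, 189), (28, 229, 0), (12, 249, 0), (21, 109, 0), (19, 109, 0),
  (23, 109, 0), (24, 249, 0), (21, 89, 169), (20, 249, 189)]

/-- Derivation steps, part 2. -/
def steps2 : List (ℕ × ℕ × ℕ) := [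
  (18, 269, 0), (24, 249, 189), (22, 249, 189), (23, 89, 169), (25, 89, 169), (21, 109, 149),
  (20, 269, 0), (25, 89, 0), (23, 109, 149), (16, 269, 0), (18, 249, 169), (23, 89, 189),
  (25, 89, 189), (20, 249, 169), (18, 269, 189), (22, 249, 169), (20, 9, 4569), (24, 9, 4569),
  (27, 69, 169), (18, 229, 149), (27, 69, 189), (27, 89, 0), (20, 229, 149), (20, 249, 9),
  (22, 249, 9), (22, 229, 149), (21, 60569, 189), (24, 249, 9), (26, 229, 189), (25, 89, 149),
  (26, 229, 169), (25, 60569, 189), (26, 9, 9), (19, 129, 229), (21, 89, 4569), (18, 229, 4569),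
  (18, 248, 189), (19, 89, 169), (19, 109, 9), (25, 129, 8), (27, 89, 4569), (20, 248, 189),
  (25, 89, 4569), (24, 248, 189), (18, 268, 0), (25, 89, 9), (23, 89, 9), (21, 52569, 0),
  (16, 249, 9), (16, 269, 189), (20, 268, 0), (29, 89, 169), (19, 109, 4569), (25, 52569, 0),
  (23, 52569, 0), (26, 9, 129), (19, 60569, 189), (19, 109, 149), (18, 249, 229), (16, 249, 169),
  (27, 89, 129), (26, 9, 4569), (29, 89, 149), (27, 109, 8), (14, 269, 0), (18, 229, 4969),
  (17, 129, 9), (19, 109, 4969), (28, 9, 169), (17, 68969, 0)]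

/-- Derivation steps, part 3. -/
def steps3 : List (ℕ × ℕ × ℕ) := [
  (16, 107829, 0), (29, 89, 0), (28, 9, 149), (26, 229, 8), (14, 269, 189), (22, 9, 4569),
  (23, 60569, 189), (22, 229, 229), (20, 229, 229), (25, 109, 129), (23, 89, 4569), (22, 248, 189),
  (24, 229, 229), (26, 228, 189), (16, 249, 229), (28, 9, 189), (29, 89, 189), (27, 52549, 189),
  (26, 227, 189), (23, 89, 0), (21, 69, 169), (25, 69, 169), (18, 269, 169), (21, 89, 149),
  (23, 89, 149), (21, 109, 129), (20, 228, 169), (23, 109, 129), (21, 52569, 169), (20, 229, 4569),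
  (24, 229, 4569), (20, 9, 76569), (27, 52569, 169), (20, 249, 149), (22, 249, 149), (20, 9, 4969),
  (25, 69, 149), (19, 60569, 169), (26, 249, 189), (25, 52569, 189), (18, 99829, 0),
  (25, 69, 4569), (20, 268, 189), (18, 229, 76569), (16, 269, 9), (29, 69, 169), (25, 109, 8),
  (26, 229, 9), (18, 99829, 189), (26, 228, 169), (19, 89, 4569), (27, 52549, 169),
  (19, 109, 76569), (29, 69, 149), (23, 129, 8), (22, 9, 4969), (17, 68569, 0), (22, 249, 8),
  (26, 9, 229), (27, 89, 4549), (26, 9, 4549), (24, 228, 169), (21, 129, 8), (25, 52569, 169),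
  (23, 69, 4569), (20, 249, 8), (25, 89, 129), (25, 60569, 9), (22, 228, 169), (22, 229, 4569)]

/-- Derivation steps, part 4. -/
def steps4 : List (ℕ × ℕ × ℕ) := [
  (23, 52569, 169), (24, 9, 4969), (20, 229, 249), (25, 60549, 189), (17, 68569, 189),
  (25, 109, 109), (23, 60569, 9), (22, 248, 9), (19, 60969, 9), (26, 9, 4969), (16, 229, 4569),
  (28, 229, 189), (17, 109, 4569), (22, 9, 76569), (21, 109, 8), (26, 9, 76569), (24, 9, 76569),
  (14, 249, 9), (21, 60569, 9), (23, 109, 8), (18, 248, 9), (20, 229, 76569), (20, 228, 149),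
  (20, 248, 9), (20, 91829, 169), (25, 44569, 189), (20, 9, 68569), (19, 60569, 9),
  (19, 52569, 169), (19, 60569, 149), (18, 249, 3829), (28, 9, 9), (17, 60569, 169),
  (25, 109, 4549), (28, 189, 4569), (21, 109, 4549), (17, 129, 149), (24, 228, 4569),
  (25, 52569, 4569), (23, 129, 7), (23, 129, 228), (25, 52569, 9), (23, 109, 4549), (21, 129, 228),
  (28, 8, 169), (29, 44569, 169), (22, 228, 149), (23, 52569, 149), (19, 109, 4549),
  (24, 229, 3829), (18, 91829, 169), (24, 229, 76569), (14, 229, 169), (15, 109, 169),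
  (22, 229, 76569), (24, 228, 149), (25, 52569, 149), (27, 52569, 149), (25, 52549, 169),
  (16, 249, 4569), (21, 89, 4549), (31, 89, 169), (19, 60569, 4569), (22, 229, 3829), (20, 248, 8),
  (22, 91829, 169), (24, 9, 68569), (20, 229, 3829), (21, 52569, 4569), (20, 228, 4569)]

/-- Derivation steps, part 5. -/
def steps5 : List (ℕ × ℕ × ℕ) := [
  (20, 9, 1836569), (18, 248, 229), (18, 99829, 169), (22, 9, 68569), (20, 249, 76569),
  (21, 109, 76549), (23, 89, 4549), (18, 229, 76969), (17, 149, 228), (21, 52549, 169),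
  (20, 91829, 149), (28, 228, 189), (23, 109, 4949), (23, 129, 227), (23, 52569, 4569),
  (22, 228, 4569), (25, 44569, 4569), (21, 60569, 229), (20, 248, 229), (23, 44569, 149),
  (23, 52569, 129), (23, 109, 76549), (20, 99429, 0), (16, 229, 4969), (17, 109, 4969),
  (25, 60569, 8), (27, 52569, 129), (25, 109, 76549), (16, 229, 76569), (14, 249, 229),
  (21, 109, 4949), (24, 228, 129), (25, 52569, 129), (20, 99829, 9), (19, 60569, 76569),
  (24, 9, 1836569), (20, 248, 228), (22, 248, 8), (23, 60569, 8), (20, 229, 91829),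
  (22, 229, 3429), (22, 91829, 149), (16, 99829, 189), (19, 109, 4949), (22, 9, 1836569),
  (19, 27436569, 0), (21, 52569, 4969), (20, 228, 4969), (22, 91828, 189), (22, 91429, 169),
  (21, 52949, 169), (20, 9, 30636569), (15, 68569, 189), (22, 99429, 0), (23, 52569, 4549),
  (23, 109, 4929), (22, 228, 229), (25, 89, 76549), (21, 60949, 189), (25, 52549, 149),
  (25, 109, 68549), (23, 52569, 76569), (22, 228, 76569), (21, 129, 3828), (24, 91828, 189),
  (20, 228, 76569), (26, 8, 4549), (23, 129, 3828), (24, 91828, 0), (25, 109, 1836549)]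

/-- Derivation steps, part 6. -/
def steps6 : List (ℕ × ℕ × ℕ) := [
  (17, 60969, 169), (24, 229, 228), (25, 60569, 7), (24, 9, 4949), (24, 228, 4549),
  (19, 27436569, 189), (22, 91828, 9), (18, 91829, 149), (18, 228, 4969), (24, 8, 76569),
  (22, 99429, 9), (21, 24236569, 169), (26, 227, 9), (26, 228, 9), (15, 129, 4569), (26, 9, 4949),
  (19, 60569, 4549), (20, 91829, 76569), (22, 91429, 149), (23, 52569, 68569), (26, 8, 4569),
  (26, 3828, 169), (12, 249, 189), (22, 9, 30636569), (18, 39931829, 0), (27, 89, 76549),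
  (26, 9, 76549), (23, 52569, 76549), (24, 229, 3828), (16, 99829, 9), (19, 109, 1836569),
  (23, 52949, 4569), (24, 9, 30636569), (29, 44569, 4569), (28, 8, 149), (21, 109, 1836549),
  (28, 9, 8), (24, 8, 68569), (21, 24236569, 149), (26, 228, 8), (17, 60569, 4569), (28, 7, 169),
  (29, 44549, 169), (30, 9, 189), (21, 60569, 4949), (18, 248, 3829), (30, 189, 149),
  (24, 99428, 0), (14, 229, 4969), (28, 227, 189), (19, 109, 1996569), (27, 24228569, 189),
  (20, 229, 1531829), (30, 189, 4569), (16, 91829, 4569), (17, 60569, 4969), (22, 99429, 8),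
  (18, 228, 1836569), (15, 68969, 189), (18, 36731829, 169), (24, 36731429, 189), (13, 149, 9),
  (20, 91429, 76569), (22, 8, 30636569), (24, 9, 30636549), (26, 8, 76549), (28, 7, 149),
  (30, 189, 129), (30, 9, 0)]

/-- All derivation steps, in order. -/
def allSteps : List (ℕ × ℕ × ℕ) :=
  steps1 ++ steps2 ++ steps3 ++ steps4 ++ steps5 ++ steps6

set_option maxRecDepth 100000 in
theorem check_true : checkAll basisData allSteps = true := by decide +kernel

/-! ### Soundness of the normal forms -/

section group

theorem braid : σ 0 * σ 1 * σ 0 = σ 1 * σ 0 * σ 1 := by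
  have h : (PresentedGroup.mk braidRels (FreeGroup.of 0 * FreeGroup.of 1 * FreeGroup.of 0 *
    (FreeGroup.of 1 * FreeGroup.of 0 * FreeGroup.of 1)⁻¹)) = 1 :=
    PresentedGroup.one_of_mem (Set.mem_singleton _)
  rw [map_mul, map_inv, mul_inv_eq_one] at h
  exact h

/-- The element `s₁s₂s₁`. -/
noncomputable def gu : B3 := σ 0 * σ 1 * σ 0
/-- The element `s₁s₂`. -/
noncomputable def gy : B3 := σ 0 * σ 1
/-- The central element. -/
noncomputable def gz : B3 := gu * gu

theorem gy_gu : gy * gy = σ 0 * gu := by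
  rw [gu, braid, gy]; group

theorem gy3 : gy * gy * gy = gz := by
  rw [gz, gy_gu]
  conv_rhs => rw [gu, braid]
  conv_lhs => rw [gu, braid, gy]
  have := braid
  calc _ = (σ 0 * σ 1 * σ 0) * σ 1 * σ 0 * σ 1 := by group
    _ = _ := by rw [braid]; group

theorem gz_u : Commute gz gu := by
  unfold gz; exact (Commute.refl gu).mul_left (Commute.refl gu)

theorem gz_y : Commute gz gy := by
  rw [← gy3]; exact ((Commute.refl gy).mul_left (Commute.refl gy)).mul_left (Commute.refl gy)

/-- Value of a letter. -/
noncomputable def Letter.val : Letter → B3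
  | U => gu
  | Y => gy
  | W => gy * gy

theorem Letter.comm (a : Letter) : Commute gz a.val := by
  cases a
  · exact gz_u
  · exact gz_y
  · exact gz_y.mul_right gz_y

/-- Value of a list of letters. -/
noncomputable def lval : List Letter → B3
  | [] => 1
  | a :: l => lval l * a.val

theorem lval_comm (l : List Letter) : Commute gz (lval l) := by
  induction l with
  | nil => exact Commute.one_right _
  | cons a l ih => exact ih.mul_right a.comm

/-- Value of a state. -/
noncomputable def val (s : St) : B3 := gz ^ s.1 * lval s.2

/-- Equality up to left multiplication by powers of `s₁`. -/
def Eqv (g h : B3) : Prop := ∃ j : ℤ, g = σ 0 ^ j * h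

theorem Eqv.of_eq {g h : B3} (e : g = h) : Eqv g h := ⟨0, by simp [e]⟩

theorem Eqv.trans {g h k : B3} : Eqv g h → Eqv h k → Eqv g k := by
  rintro ⟨i, rfl⟩ ⟨j, rfl⟩
  exact ⟨i + j, by rw [zpow_add, mul_assoc]⟩

theorem Eqv.mul_right {g h : B3} (k : B3) : Eqv g h → Eqv (g * k) (h * k) := by
  rintro ⟨i, rfl⟩
  exact ⟨i, by rw [mul_assoc]⟩

theorem val_cons (k : ℤ) (a : Letter) (l : List Letter) : val (k, a :: l) = val (k, l) * a.val := by
  simp [val, lval, mul_assoc]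

theorem val_succ (k : ℤ) (l : List Letter) : val (k + 1, l) = val (k, l) * gz := by
  simp only [val]
  rw [zpow_add, zpow_one, mul_assoc, mul_assoc, (lval_comm l).eq]

theorem gz_s0 : Commute gz (σ 0) := by
  have h : σ 0 = gy⁻¹ * gu := by
    rw [gu, gy]
    group
  rw [h]
  exact gz_y.inv_right.mul_right gz_u

theorem val_nil (k : ℤ) : val (k, []) = gz ^ k := by simp [val, lval]

theorem mulU_sound (s : St) : Eqv (val (mulU s)) (val s * gu) := by
  unfold mulU
  split
  · rename_i k
    refine ⟨1, ?_⟩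
    rw [val_cons, val_nil, Letter.val, gy_gu, zpow_one, ← mul_assoc, ← mul_assoc,
      (gz_s0.zpow_left k).eq]
  · rename_i k
    refine ⟨-1, ?_⟩
    rw [val_cons, val_nil, val_nil, Letter.val, gy_gu, zpow_neg, zpow_one, eq_inv_mul_iff_mul_eq,
      ← mul_assoc, (gz_s0.zpow_left k).eq, zpow_add, zpow_one, gz]
    simp only [mul_assoc]
  · rename_i k l
    refine Eqv.of_eq ?_
    rw [val_succ, val_cons, Letter.val, gz, mul_assoc]
  · exact Eqv.of_eq (val_cons _ _ _)

theorem mulY_sound (s : St) : Eqv (val (mulY s)) (val s * gy) := by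
  unfold mulY
  split
  · refine Eqv.of_eq ?_
    rw [val_cons, val_cons, Letter.val, Letter.val, mul_assoc]
  · refine Eqv.of_eq ?_
    rw [val_succ, val_cons, Letter.val, ← gy3]
    simp only [mul_assoc]
  · exact Eqv.of_eq (val_cons _ _ _)

theorem dz_sound (s : St) : val (dz s) = val s * gz⁻¹ := by
  rw [eq_mul_inv_iff_mul_eq, ← val_succ]
  simp [dz]

theorem gen_sound (c : Bool) (s : St) :
    Eqv (val (gen c s)) (val s * σ (cond c 1 0)) := by
  cases c
  · have h := ((mulU_sound (mulY (mulY s))).trans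
      (((mulY_sound (mulY s)).trans ((mulY_sound s).mul_right gy)).mul_right gu)).mul_right gz⁻¹
    rw [← dz_sound] at h
    refine h.trans (Eqv.of_eq ?_)
    have h2 : gy * gy * gu * gz⁻¹ = σ 0 := by
      rw [gy_gu, gz]; group
    show _ = val s * σ 0
    rw [← h2]
    simp only [mul_assoc]
  · have h := ((mulY_sound (mulY (mulU s))).trans
      (((mulY_sound (mulU s)).trans ((mulU_sound s).mul_right gy)).mul_right gy)).mul_right gz⁻¹
    rw [← dz_sound] at h
    refine h.trans (Eqv.of_eq ?_)
    have h2 : gu * gy * gy * gz⁻¹ = σ 1 := by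
      rw [mul_inv_eq_iff_eq_mul, ← gy3, gu, braid, gy]
      simp only [mul_assoc]
    show _ = val s * σ 1
    rw [← h2]
    simp only [mul_assoc]

theorem genInv_sound (c : Bool) (s : St) :
    Eqv (val (genInv c s)) (val s * (σ (cond c 1 0))⁻¹) := by
  cases c
  · have h := ((mulY_sound (mulU s)).trans ((mulU_sound s).mul_right gy)).mul_right gz⁻¹
    rw [← dz_sound] at h
    refine h.trans (Eqv.of_eq ?_)
    have h2 : gu * gy * gz⁻¹ = (σ 0)⁻¹ := by
      rw [mul_inv_eq_iff_eq_mul, eq_inv_mul_iff_mul_eq, ← gy3, ← mul_assoc, ← gy_gu]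
    show _ = val s * (σ 0)⁻¹
    rw [← h2]
    simp only [mul_assoc]
  · have h := ((mulU_sound (mulY s)).trans ((mulY_sound s).mul_right gu)).mul_right gz⁻¹
    rw [← dz_sound] at h
    refine h.trans (Eqv.of_eq ?_)
    have h2 : gy * gu * gz⁻¹ = (σ 1)⁻¹ := by
      rw [mul_inv_eq_iff_eq_mul, eq_inv_mul_iff_mul_eq, gz, ← mul_assoc]
      congr 1
      rw [gu, braid, gy, mul_assoc]
    show _ = val s * (σ 1)⁻¹
    rw [← h2]
    simp only [mul_assoc]

theorem rep_sound {f : St → St} {g : B3} (hf : ∀ s, Eqv (val (f s)) (val s * g)) (n : ℕ) :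
    ∀ s, Eqv (val (rep f n s)) (val s * g ^ n) := by
  induction n with
  | zero => intro s; exact Eqv.of_eq (by simp [rep])
  | succ n ih =>
    intro s
    refine ((ih (f s)).trans ((hf s).mul_right _)).trans (Eqv.of_eq ?_)
    rw [mul_assoc, ← pow_succ']

theorem pw_sound (c : Bool) (d : ℕ) :
    ∃ g : B3, ∀ s, Eqv (val (pw c d s)) (val s * g) := by
  unfold pw
  split
  · exact ⟨_, rep_sound (gen_sound c) _⟩
  · exact ⟨_, rep_sound (genInv_sound c) _⟩

theorem act_sound (f : ℕ) : ∀ (c : Bool) (m : ℕ),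
    ∃ g : B3, ∀ s, Eqv (val (act f c m s)) (val s * g) := by
  induction f with
  | zero => intro c m; exact ⟨1, fun s => Eqv.of_eq (by simp [act])⟩
  | succ f ih =>
    intro c m
    unfold act
    split
    · exact ⟨1, fun s => Eqv.of_eq (by simp)⟩
    · obtain ⟨g, hg⟩ := pw_sound c (m % 20)
      obtain ⟨h, hh⟩ := ih (!c) (m / 20)
      refine ⟨g * h, fun s => ?_⟩
      have := (hh (pw c (m % 20) s)).trans ((hg s).mul_right h)
      rwa [mul_assoc] at this

/-- All states of a tree satisfy a predicate. -/
def STree.All (P : St → Prop) : STree → Prop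
  | leaf => True
  | node l _ s r => l.All P ∧ P s ∧ r.All P

theorem STree.ins_all {P : St → Prop} {s : St} (hs : P s) (k : ℕ) :
    ∀ t : STree, t.All P → (t.ins k s).All P
  | leaf, _ => ⟨trivial, hs, trivial⟩
  | node l k' s' r, ⟨h1, h2, h3⟩ => by
    unfold STree.ins
    split
    · exact ⟨ins_all hs k l h1, h2, h3⟩
    · exact ⟨h1, h2, ins_all hs k r h3⟩

theorem STree.mem_all {P : St → Prop} {s : St} {k : ℕ} :
    ∀ t : STree, t.All P → t.mem k s = true → P s
  | leaf, _, h => by simp [STree.mem] at h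
  | node l k' s' r, ⟨h1, h2, h3⟩, h => by
    unfold STree.mem at h
    split at h
    · rw [of_decide_eq_true h]; exact h2
    · split at h
      · exact mem_all l h1 h
      · exact mem_all r h3 h

theorem mv_sound (dir : ℕ) : ∃ j : ℤ, (j = 1 ∨ j = -1) ∧
    ∀ s, Eqv (val (mv dir s)) (val s * σ 0 ^ j) := by
  unfold mv
  split
  · exact ⟨-1, Or.inr rfl, fun s => by simpa using genInv_sound false s⟩
  · exact ⟨1, Or.inl rfl, fun s => by simpa using gen_sound false s⟩

theorem stepOk_sound {P : B3 → Prop} (hP : ∀ g h, Eqv g h → P g → P h) {t : STree}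
    (ht : t.All (fun s => P (val s))) {dir p : ℕ} {j : ℤ} {w : B3}
    (hj : ∀ s, Eqv (val (mv dir s)) (val s * σ 0 ^ j))
    (hw : ∀ s, Eqv (val (act 12 true p s)) (val s * w)) (n : ℕ) :
    ∀ s, stepOk t dir p s n = true →
      ∀ k : ℕ, k < n → P (val s * (σ 0 ^ j) ^ (k + 1) * w) := by
  induction n with
  | zero => intro s _ k hk; omega
  | succ n ih =>
    intro s h k hk
    unfold stepOk at h
    split at h
    · rename_i h1
      have hp := STree.mem_all t ht h1
      rcases k with _ | k
      · rw [zero_add, pow_one]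
        exact hP _ _ ((hw _).trans ((hj s).mul_right w)) hp
      · have := ih _ h k (by omega)
        refine hP _ _ ?_ this
        have h2 := (((hj s).mul_right ((σ 0 ^ j) ^ (k + 1))).mul_right w)
        rwa [mul_assoc (val s), ← pow_succ'] at h2
    · simp at h

theorem run_sound {P : B3 → Prop} (hP : ∀ g h, Eqv g h → P g → P h)
    (hP' : ∀ g h, Eqv g h → P h → P g)
    (line : ∀ q w : B3, ∀ j : ℤ, (j = 1 ∨ j = -1) →
      (∀ k : ℕ, k < 5 → P (q * (σ 0 ^ j) ^ (k + 1) * w)) → P (q * w)) :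
    ∀ (ss : List (ℕ × ℕ × ℕ)) (t t' : STree), t.All (fun s => P (val s)) →
      run ss t = some t' → t'.All (fun s => P (val s))
  | [], t, t', ht, h => by
    simp only [run, Option.some.injEq] at h
    rw [← h]; exact ht
  | (n, q, p) :: ss, t, t', ht, h => by
    unfold run at h
    split at h
    · rename_i h1
      refine run_sound hP hP' line ss _ t' ?_ h
      refine STree.ins_all (P := fun s => P (val s)) ?_ _ t ht
      obtain ⟨w, hw⟩ := act_sound 12 true p
      obtain ⟨j, hj1, hj⟩ := mv_sound (n % 2)
      have := stepOk_sound hP ht hj hw 5 _ h1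
      exact hP' _ _ (hw _) (line _ _ j hj1 this)
    · simp at h

theorem initTree_sound {P : St → Prop} :
    ∀ (b : List (ℕ × ℕ)), (∀ x ∈ b, P (ofData x)) → (initTree b).All P
  | [], _ => trivial
  | x :: l, h => by
    unfold initTree
    exact STree.ins_all (h x (by simp)) _ _ (initTree_sound l fun y hy => h y (by simp [hy]))

theorem finalOk_sound {P : B3 → Prop} (hP : ∀ g h, Eqv g h → P g → P h) {t : STree}
    (ht : t.All (fun s => P (val s))) :
    ∀ (b : List (ℕ × ℕ)), finalOk t b = true →
      P 1 ∧ ∀ x ∈ b, P (val (ofData x) * σ 0) ∧ P (val (ofData x) * σ 1)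
  | [], h => by
    refine ⟨?_, by simp⟩
    have := STree.mem_all t ht h
    simpa [val, lval] using this
  | x :: l, h => by
    unfold finalOk at h
    split at h
    · rename_i h0 h1
      obtain ⟨i1, i2⟩ := finalOk_sound hP ht l h
      refine ⟨i1, ?_⟩
      intro y hy
      rcases List.mem_cons.1 hy with rfl | hy
      · exact ⟨hP _ _ (gen_sound false _) (STree.mem_all t ht h0),
          hP _ _ (gen_sound true _) (STree.mem_all t ht h1)⟩
      · exact i2 y hy
    · simp at h

theorem main_comb (b : List (ℕ × ℕ)) (ss : List (ℕ × ℕ × ℕ)) (hc : checkAll b ss = true)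
    (P : B3 → Prop) (hl : ∀ (j : ℤ) g, P g → P (σ 0 ^ j * g))
    (line : ∀ q w : B3, ∀ j : ℤ, (j = 1 ∨ j = -1) →
      (∀ k : ℕ, k < 5 → P (q * (σ 0 ^ j) ^ (k + 1) * w)) → P (q * w))
    (hb : ∀ x ∈ b, P (val (ofData x))) :
    P 1 ∧ ∀ x ∈ b, P (val (ofData x) * σ 0) ∧ P (val (ofData x) * σ 1) := by
  have hP' : ∀ g h, Eqv g h → P h → P g := by
    rintro g h ⟨j, rfl⟩ hh
    exact hl j h hh
  have hP : ∀ g h, Eqv g h → P g → P h := by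
    rintro g h ⟨j, rfl⟩ hh
    have := hl (-j) _ hh
    rwa [← mul_assoc, ← zpow_add, neg_add_cancel, zpow_zero, one_mul] at this
  unfold checkAll at hc
  split at hc
  · rename_i t h
    exact finalOk_sound hP (run_sound hP hP' line _ _ _ (initTree_sound _ hb) h) _ hc
  · simp at hc

end group

/-! ### The algebra part -/

section algebra

/-- The image of the braid group in `H₅`. -/
noncomputable def toH5 : B3 →* H5 :=
  ((RingQuot.mkAlgHom R5 quinticRel : MonoidAlgebra R5 B3 →ₐ[R5] H5) :
    MonoidAlgebra R5 B3 →* H5).comp (MonoidAlgebra.of R5 B3)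

theorem quint (i : Fin 2) : toH5 (σ i ^ 5) = cf5 0 • toH5 (σ i ^ 4) + cf5 1 • toH5 (σ i ^ 3) +
    cf5 2 • toH5 (σ i ^ 2) + cf5 3 • toH5 (σ i) + cf5 4 • (1 : H5) := by
  have h := RingQuot.mkAlgHom_rel R5 (quinticRel.rel i)
  simp only [map_add, map_smul, map_pow, map_one] at h
  simp only [map_pow]
  exact h

theorem e_unit : IsUnit (cf5 4) :=
  IsLocalization.Away.algebraMap_isUnit (S := R5) (MvPolynomial.X 4 : MvPolynomial (Fin 5) ℤ)

theorem quint_inv (i : Fin 2) : (1 : H5) = cf5 0 • toH5 ((σ i)⁻¹ ^ 1) + cf5 1 • toH5 ((σ i)⁻¹ ^ 2) +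
    cf5 2 • toH5 ((σ i)⁻¹ ^ 3) + cf5 3 • toH5 ((σ i)⁻¹ ^ 4) + cf5 4 • toH5 ((σ i)⁻¹ ^ 5) := by
  have h := congrArg (· * toH5 ((σ i)⁻¹ ^ 5)) (quint i)
  simp only [add_mul, smul_mul_assoc, one_mul, ← map_mul] at h
  have e5 : σ i ^ 5 * (σ i)⁻¹ ^ 5 = 1 := by group
  have e4 : σ i ^ 4 * (σ i)⁻¹ ^ 5 = (σ i)⁻¹ ^ 1 := by group
  have e3 : σ i ^ 3 * (σ i)⁻¹ ^ 5 = (σ i)⁻¹ ^ 2 := by group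
  have e2 : σ i ^ 2 * (σ i)⁻¹ ^ 5 = (σ i)⁻¹ ^ 3 := by group
  have e1 : σ i * (σ i)⁻¹ ^ 5 = (σ i)⁻¹ ^ 4 := by group
  rw [e5, e4, e3, e2, e1, map_one] at h
  exact h

theorem mem_of_sum {M : Type*} [AddCommMonoid M] [Module R5 M] (U : Submodule R5 M) {x y z : M}
    (e : z = x + y) (hz : z ∈ U) (hx : x ∈ U) : y ∈ U := by
  have h : (-1 : R5) • x + z = y := by
    rw [e, ← add_assoc]
    nth_rewrite 2 [← one_smul R5 x]
    rw [← add_smul, neg_add_cancel, zero_smul, zero_add]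
  rw [← h]
  exact U.add_mem (U.smul_mem _ hx) hz

theorem line_pos (U : Submodule R5 H5) (i : Fin 2) (q w : H5)
    (h : ∀ k : ℕ, k < 5 → q * toH5 (σ i ^ (k + 1)) * w ∈ U) : q * w ∈ U := by
  have e := congrArg (fun x => q * x * w) (quint i)
  simp only [mul_add, add_mul, smul_mul_assoc, mul_smul_comm, mul_one] at e
  rw [← Submodule.smul_mem_iff_of_isUnit U e_unit]
  have h1 := h 0 (by norm_num)
  rw [zero_add, pow_one] at h1
  exact mem_of_sum U e (h 4 (by norm_num)) (U.add_mem (U.add_mem (U.add_mem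
    (U.smul_mem _ (h 3 (by norm_num))) (U.smul_mem _ (h 2 (by norm_num))))
    (U.smul_mem _ (h 1 (by norm_num)))) (U.smul_mem _ h1))

theorem line_neg (U : Submodule R5 H5) (i : Fin 2) (q w : H5)
    (h : ∀ k : ℕ, k < 5 → q * toH5 ((σ i)⁻¹ ^ (k + 1)) * w ∈ U) : q * w ∈ U := by
  have e := congrArg (fun x => q * x * w) (quint_inv i)
  simp only [mul_add, add_mul, smul_mul_assoc, mul_smul_comm, mul_one] at e
  rw [e]
  exact U.add_mem (U.add_mem (U.add_mem (U.add_mem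
    (U.smul_mem _ (h 0 (by norm_num))) (U.smul_mem _ (h 1 (by norm_num))))
    (U.smul_mem _ (h 2 (by norm_num)))) (U.smul_mem _ (h 3 (by norm_num))))
    (U.smul_mem _ (h 4 (by norm_num)))

theorem left_inv_closed (U : Submodule R5 H5) (i : Fin 2) (h : ∀ x ∈ U, toH5 (σ i) * x ∈ U) :
    ∀ x ∈ U, toH5 (σ i)⁻¹ * x ∈ U := by
  intro x hx
  refine line_pos U i _ _ fun k _ => ?_
  rw [← map_mul, pow_succ', inv_mul_cancel_left]
  induction k with
  | zero => simpa using hx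
  | succ k ih => rw [pow_succ', map_mul, mul_assoc]; exact h _ (ih (by omega))

theorem right_inv_closed (U : Submodule R5 H5) (i : Fin 2) (h : ∀ x ∈ U, x * toH5 (σ i) ∈ U) :
    ∀ x ∈ U, x * toH5 (σ i)⁻¹ ∈ U := by
  intro x hx
  refine line_pos U i _ _ fun k _ => ?_
  rw [mul_assoc, ← map_mul, pow_succ, mul_inv_cancel_right]
  induction k with
  | zero => simpa using hx
  | succ k ih => rw [pow_succ, map_mul, ← mul_assoc]; exact h _ (ih (by omega))

/-- The spanning family attached to a list of representatives. -/
noncomputable def fam (b : List (ℕ × ℕ)) (x : Fin 5 × Fin b.length) : H5 :=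
  toH5 (σ 0 ^ (x.1 : ℕ)) * toH5 (val (ofData b[x.2]))

theorem fam_top (b : List (ℕ × ℕ)) (ss : List (ℕ × ℕ × ℕ)) (hc : checkAll b ss = true) :
    Submodule.span R5 (Set.range (fam b)) = ⊤ := by
  set U := Submodule.span R5 (Set.range (fam b)) with hU
  have hgen : ∀ x ∈ b, ∀ i : ℕ, i < 5 → toH5 (σ 0 ^ i) * toH5 (val (ofData x)) ∈ U := by
    intro x hx i hi
    obtain ⟨n, hn, rfl⟩ := List.getElem_of_mem hx
    exact Submodule.subset_span ⟨(⟨i, hi⟩, ⟨n, hn⟩), rfl⟩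
  -- left closure
  have hA : ∀ x ∈ U, toH5 (σ 0) * x ∈ U := by
    intro x hx
    induction hx using Submodule.span_induction with
    | mem x h =>
      obtain ⟨⟨⟨i, hi⟩, n⟩, rfl⟩ := h
      simp only [fam]
      rw [← mul_assoc, ← map_mul, ← pow_succ']
      have hb : b[n] ∈ b := List.getElem_mem _
      by_cases h4 : i = 4
      · subst h4
        rw [quint]
        simp only [add_mul, smul_mul_assoc]
        have h0 := hgen _ hb 0 (by norm_num)
        have h1 := hgen _ hb 1 (by norm_num)
        rw [pow_zero, map_one] at h0
        rw [pow_one] at h1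
        exact U.add_mem (U.add_mem (U.add_mem (U.add_mem
          (U.smul_mem _ (hgen _ hb 4 (by norm_num))) (U.smul_mem _ (hgen _ hb 3 (by norm_num))))
          (U.smul_mem _ (hgen _ hb 2 (by norm_num)))) (U.smul_mem _ h1)) (U.smul_mem _ h0)
      · exact hgen _ hb (i + 1) (by omega)
    | zero => simp
    | add x y _ _ hx hy => rw [mul_add]; exact U.add_mem hx hy
    | smul r x _ hx => rw [mul_smul_comm]; exact U.smul_mem _ hx
  have hA' := left_inv_closed U 0 hA
  have hZ : ∀ (j : ℤ) x, x ∈ U → toH5 (σ 0 ^ j) * x ∈ U := by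
    intro j
    induction j using Int.induction_on with
    | zero => intro x hx; simpa using hx
    | succ j ih =>
      intro x hx
      rw [zpow_add, zpow_one, map_mul, mul_assoc]
      exact ih _ (hA x hx)
    | pred j ih =>
      intro x hx
      rw [zpow_sub, zpow_one, map_mul, mul_assoc]
      exact ih _ (hA' x hx)
  obtain ⟨h1, hb⟩ := main_comb b ss hc (fun g => toH5 g ∈ U)
    (fun j g hg => by rw [map_mul]; exact hZ j _ hg)
    (by
      rintro q w j (rfl | rfl) h
      · rw [map_mul]
        refine line_pos U 0 _ _ fun k hk => ?_
        have := h k hk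
        rwa [zpow_one, map_mul, map_mul] at this
      · rw [map_mul]
        refine line_neg U 0 _ _ fun k hk => ?_
        have := h k hk
        rwa [zpow_neg, zpow_one, map_mul, map_mul] at this)
    (fun x hx => by simpa using hgen x hx 0 (by norm_num))
  have hR : ∀ i : Fin 2, ∀ x ∈ U, x * toH5 (σ i) ∈ U := by
    intro i x hx
    induction hx using Submodule.span_induction with
    | mem x h =>
      obtain ⟨⟨⟨m, hm⟩, n⟩, rfl⟩ := h
      simp only [fam]
      have hbn : b[n] ∈ b := List.getElem_mem _
      rw [mul_assoc, ← map_mul, ← zpow_natCast]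
      refine hZ _ _ ?_
      fin_cases i
      · exact (hb _ hbn).1
      · exact (hb _ hbn).2
    | zero => simp
    | add x y _ _ hx hy => rw [add_mul]; exact U.add_mem hx hy
    | smul r x _ hx => rw [smul_mul_assoc]; exact U.smul_mem _ hx
  have hR' := fun i => right_inv_closed U i (hR i)
  have hall : ∀ g : B3, ∀ x ∈ U, x * toH5 g ∈ U := by
    intro g
    have hg : g ∈ Subgroup.closure (Set.range σ) := by
      have := PresentedGroup.closure_range_of braidRels
      have h2 : Subgroup.closure (Set.range σ) = ⊤ := this
      rw [h2]; trivial
    induction hg using Subgroup.closure_induction'' with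
    | mem x hx => obtain ⟨i, rfl⟩ := hx; exact hR i
    | inv_mem x hx => obtain ⟨i, rfl⟩ := hx; exact hR' i
    | one => intro x hx; simpa using hx
    | mul x y _ _ hx hy =>
      intro u hu
      rw [map_mul, ← mul_assoc]
      exact hy _ (hx _ hu)
  rw [eq_top_iff]
  rintro x -
  obtain ⟨m, rfl⟩ := RingQuot.mkAlgHom_surjective R5 quinticRel x
  induction m using MonoidAlgebra.induction_on with
  | of g =>
    have := hall g _ h1
    rwa [map_one, one_mul] at this
  | add x y hx hy => rw [map_add]; exact U.add_mem hx hy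
  | smul r x hx => rw [map_smul]; exact U.smul_mem _ hx

/-- A specialisation of the coefficients. -/
noncomputable def spec : R5 →+* ℤ :=
  IsLocalization.Away.lift (S := R5) (MvPolynomial.X 4 : MvPolynomial (Fin 5) ℤ)
    (g := (MvPolynomial.aeval (fun i : Fin 5 => if i = 4 then (1 : ℤ) else 0)).toRingHom)
    (by simp)

theorem spec_cf (i : Fin 5) : spec (cf5 i) = if i = 4 then 1 else 0 := by
  unfold spec cf5
  rw [IsLocalization.Away.lift_eq]
  simp

/-- The corresponding character of the group algebra. -/
noncomputable def chi : MonoidAlgebra R5 B3 →+* ℤ :=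
  MonoidAlgebra.liftNCRingHom spec (1 : B3 →* ℤ) (fun _ _ => Commute.all _ _)

theorem chi_smul (r : R5) (x : MonoidAlgebra R5 B3) : chi (r • x) = spec r * chi x :=
  MonoidAlgebra.liftNC_smul _ _ _ _

theorem chi_of (g : B3) : chi (MonoidAlgebra.of R5 B3 g) = 1 := by
  simp [chi]

instance : Infinite H5 := by
  let f : H5 →+* ℤ := RingQuot.lift ⟨chi, by
    rintro _ _ ⟨i⟩
    simp only [map_add, map_pow, chi_smul, chi_of, spec_cf, map_one]
    simp⟩
  refine Infinite.of_injective (fun n : ℕ => (n : H5)) fun m n h => ?_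
  have h2 : f (m : H5) = f (n : H5) := congrArg f h
  rw [map_natCast, map_natCast] at h2
  exact_mod_cast h2

end algebra

theorem H5_generated_by_600_elements :
    (∃ S : Finset H5, S.card = 600 ∧ Submodule.span R5 (S : Set H5) = ⊤) ∧
    Module.Finite R5 H5 := by
  classical
  have hlen : basisData.length = 120 := by decide +kernel
  have htop := fam_top basisData allSteps check_true
  have hcard : (Finset.univ.image (fam basisData)).card ≤ 600 := by
    refine Finset.card_image_le.trans ?_
    rw [Finset.card_univ, Fintype.card_prod, Fintype.card_fin, Fintype.card_fin, hlen]
  obtain ⟨S, hS, hS2⟩ := Infinite.exists_superset_card_eq _ 600 hcard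
  have hspan : Submodule.span R5 (S : Set H5) = ⊤ := by
    rw [eq_top_iff, ← htop]
    refine Submodule.span_mono ?_
    rintro _ ⟨x, rfl⟩
    exact hS (Finset.mem_image_of_mem _ (Finset.mem_univ x))
  exact ⟨⟨S, hS2, hspan⟩, ⟨⟨S, hspan⟩⟩⟩
end
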